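/- arXiv:1608.06880 — 2 statements merged into one kernel-verified Lean document; each statement's English description precedes it below -/
import Mathlib

section
/- For every integer n ≥ 1 the following four identities hold: (i) Σ_{k=1}^{n} (−1)^k B_{n,k}(−0!, −1!, …, −(n−k)!) = n!, where the j-th argument is −(j−1)!; (ii) Σ_{k=1}^{n} (−1)^k B_{n,k}(0!, −1!, …, (−1)^{n−k}(n−k)!) = (−1)^n n!, where the j-th argument is (−1)^{j−1}(j−1)!; (iii) Σ_{k=1}^{n} B_{n,k}(−0!, 1!, …, (−1)^{n−k+1}(n−k)!) = (−1)^n n!, where the j-th argument is (−1)^j(j−1)!; (iv) Σ_{k=1}^{n} B_{n,k}(0!, 1!, …, (n−k)!) = n!, where the j-th argument is (j−1)!. -/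
/-- The partition set `Λ^k_n` as a finset: functions `ℕ → ℕ` supported on `{1, …, n-k+1}`
with `k_1 + ⋯ + k_{n-k+1} = k` and `1·k_1 + 2·k_2 + ⋯ + (n-k+1)·k_{n-k+1} = n`. -/
def lambdaSet (n k : ℕ) : Finset (ℕ → ℕ) :=
  (Finset.piAntidiag (Finset.Icc 1 (n - k + 1)) k).filter
    (fun v => ∑ j ∈ Finset.Icc 1 (n - k + 1), j * v j = n)

/-- The partial exponential Bell polynomial
`B_{n,k}(u_1, …, u_{n-k+1}) = n! Σ_{Λ^k_n} Π_j (1/k_j!) (u_j/j!)^{k_j}`. -/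
noncomputable def bellB (n k : ℕ) (u : ℕ → ℝ) : ℝ :=
  (Nat.factorial n : ℝ) * ∑ v ∈ lambdaSet n k, ∏ j ∈ Finset.Icc 1 (n - k + 1),
    (1 / (Nat.factorial (v j) : ℝ)) * (u j / (Nat.factorial j : ℝ)) ^ (v j)

/-- The partial ordinary Bell polynomial
`B̂_{n,k}(u_1, …, u_{n-k+1}) = k! Σ_{Λ^k_n} Π_j u_j^{k_j}/k_j!`. -/
noncomputable def bellBhat (n k : ℕ) (u : ℕ → ℝ) : ℝ :=
  (Nat.factorial k : ℝ) * ∑ v ∈ lambdaSet n k, ∏ j ∈ Finset.Icc 1 (n - k + 1),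
    (u j) ^ (v j) / (Nat.factorial (v j) : ℝ)

open Finset Classical in
/-- The multiplicity functions supported on `{1, …, N}` of the integer partitions of `n`. -/
noncomputable def multiplicitySet (N n : ℕ) : Finset (ℕ → ℕ) :=
  (range (n + 1)).biUnion fun k =>
    (piAntidiag (Icc 1 N) k).filter (fun v => ∑ j ∈ Icc 1 N, j * v j = n)

/-- The cycle index weight `∏ j, 1 / (v_j! j ^ v_j)`. -/
noncomputable def cycleWeight (N : ℕ) (v : ℕ → ℕ) : ℝ :=
  ∏ j ∈ Finset.Icc 1 N, (1 / (Nat.factorial (v j) : ℝ)) * (1 / (j : ℝ)) ^ v j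

lemma mem_multiplicitySet {N n : ℕ} {v : ℕ → ℕ} :
    v ∈ multiplicitySet N n ↔
      ∑ j ∈ Finset.Icc 1 N, j * v j = n ∧ ∀ j, v j ≠ 0 → j ∈ Finset.Icc 1 N := by
  simp only [multiplicitySet, Finset.mem_biUnion, Finset.mem_filter, Finset.mem_piAntidiag,
    Finset.mem_range]
  constructor
  · rintro ⟨k, -, ⟨-, h⟩, h'⟩
    exact ⟨h', h⟩
  · rintro ⟨h', h⟩
    refine ⟨_, ?_, ⟨rfl, h⟩, h'⟩
    rw [Nat.lt_succ_iff, ← h']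
    exact Finset.sum_le_sum fun j hj =>
      Nat.le_mul_of_pos_left _ (Finset.mem_Icc.mp hj).1

lemma sum_mul_update_add_one {N i : ℕ} (hi : i ∈ Finset.Icc 1 N) (v : ℕ → ℕ) :
    ∑ j ∈ Finset.Icc 1 N, j * Function.update v i (v i + 1) j =
      ∑ j ∈ Finset.Icc 1 N, j * v j + i := by
  rw [← Finset.add_sum_erase _ _ hi, ← Finset.add_sum_erase _ (fun j => j * v j) hi,
    Function.update_self, Finset.sum_congr rfl fun j hj => by
      rw [Function.update_of_ne (Finset.ne_of_mem_erase hj)]]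
  ring

lemma cycleWeight_update_add_one {N i : ℕ} (hi : i ∈ Finset.Icc 1 N) (v : ℕ → ℕ) :
    ((i * (v i + 1) : ℕ) : ℝ) * cycleWeight N (Function.update v i (v i + 1)) =
      cycleWeight N v := by
  have hi0 : (i : ℝ) ≠ 0 := by
    exact_mod_cast Nat.one_le_iff_ne_zero.mp (Finset.mem_Icc.mp hi).1
  unfold cycleWeight
  rw [← Finset.mul_prod_erase _ _ hi, ← Finset.mul_prod_erase (Finset.Icc 1 N) _ hi,
    Function.update_self, Finset.prod_congr rfl fun j hj => by
      rw [Function.update_of_ne (Finset.ne_of_mem_erase hj)], ← mul_assoc]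
  congr 1
  have h1 : (v i : ℝ) + 1 ≠ 0 := by positivity
  rw [Nat.factorial_succ, pow_succ]
  push_cast
  field_simp

lemma sum_mul_cycleWeight {N n i : ℕ} (hi : i ∈ Finset.Icc 1 N) (hin : i ≤ n) :
    ∑ v ∈ multiplicitySet N n, ((i * v i : ℕ) : ℝ) * cycleWeight N v =
      ∑ v ∈ multiplicitySet N (n - i), cycleWeight N v := by
  rw [← Finset.sum_filter_of_ne (p := fun v => v i ≠ 0)
    (by intro v _ h h0; simp [h0] at h)]
  symm
  refine Finset.sum_bij' (fun v _ => Function.update v i (v i + 1))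
    (fun v _ => Function.update v i (v i - 1)) ?_ ?_ ?_ ?_ ?_
  · intro v hv
    rw [mem_multiplicitySet] at hv
    rw [Finset.mem_filter, mem_multiplicitySet, sum_mul_update_add_one hi, hv.1]
    refine ⟨⟨by omega, fun j hj => ?_⟩, by simp⟩
    by_cases h : j = i
    · exact h ▸ hi
    · exact hv.2 j (by rwa [Function.update_of_ne h] at hj)
  · intro v hv
    rw [Finset.mem_filter, mem_multiplicitySet] at hv
    obtain ⟨⟨hs, hsupp⟩, h0⟩ := hv
    have h := sum_mul_update_add_one hi (Function.update v i (v i - 1))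
    rw [Function.update_self, Function.update_idem, Nat.sub_add_cancel (by omega),
      Function.update_eq_self, hs] at h
    refine mem_multiplicitySet.mpr ⟨by omega, fun j hj => ?_⟩
    by_cases h : j = i
    · exact h ▸ hi
    · exact hsupp j (by rwa [Function.update_of_ne h] at hj)
  · intro v _
    simp
  · intro v hv
    have h0 : v i ≠ 0 := (Finset.mem_filter.mp hv).2
    simp [Nat.sub_add_cancel (Nat.one_le_iff_ne_zero.mpr h0)]
  · intro v _
    rw [Function.update_self, cycleWeight_update_add_one hi]

/-- The cycle index weights of the partitions of `n` sum to one. -/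
lemma sum_cycleWeight {N n : ℕ} (hnN : n ≤ N) :
    ∑ v ∈ multiplicitySet N n, cycleWeight N v = 1 := by
  induction n using Nat.strong_induction_on with
  | _ n ih =>
  rcases Nat.eq_zero_or_pos n with rfl | hn
  · have h : multiplicitySet N 0 = {0} := by
      ext v
      rw [mem_multiplicitySet, Finset.mem_singleton, Finset.sum_eq_zero_iff]
      constructor
      · rintro ⟨h, h'⟩
        funext j
        by_contra hj
        have hj' := h' j hj
        have := (Finset.mem_Icc.mp hj').1
        rcases Nat.mul_eq_zero.mp (h j hj') with h | h
        · omega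
        · exact hj h
      · rintro rfl
        simp
    simp [h, cycleWeight]
  · have hn0 : (n : ℝ) ≠ 0 := by positivity
    have key : (n : ℝ) * ∑ v ∈ multiplicitySet N n, cycleWeight N v = n := calc
      _ = ∑ v ∈ multiplicitySet N n, ∑ i ∈ Finset.Icc 1 N,
            ((i * v i : ℕ) : ℝ) * cycleWeight N v := by
        rw [Finset.mul_sum]
        refine Finset.sum_congr rfl fun v hv => ?_
        rw [← Finset.sum_mul, ← Nat.cast_sum, (mem_multiplicitySet.mp hv).1]
      _ = ∑ i ∈ Finset.Icc 1 N, ∑ v ∈ multiplicitySet N n,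
            ((i * v i : ℕ) : ℝ) * cycleWeight N v := Finset.sum_comm
      _ = ∑ i ∈ Finset.Icc 1 n, ∑ v ∈ multiplicitySet N n,
            ((i * v i : ℕ) : ℝ) * cycleWeight N v := by
        refine (Finset.sum_subset (Finset.Icc_subset_Icc_right hnN) fun i hi hin => ?_).symm
        refine Finset.sum_eq_zero fun v hv => ?_
        have hle := Finset.single_le_sum (f := fun j => j * v j) (fun _ _ => Nat.zero_le _) hi
        rw [(mem_multiplicitySet.mp hv).1] at hle
        have hlt : n < i := by
          rw [Finset.mem_Icc] at hi hin
          omega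
        have h0 : v i = 0 := by
          by_contra h
          have := Nat.le_mul_of_pos_right i (Nat.pos_of_ne_zero h)
          omega
        simp [h0]
      _ = ∑ i ∈ Finset.Icc 1 n, (1 : ℝ) := by
        refine Finset.sum_congr rfl fun i hi => ?_
        have hi' := Finset.mem_Icc.mp hi
        rw [sum_mul_cycleWeight (Finset.Icc_subset_Icc_right hnN hi) hi'.2,
          ih (n - i) (by omega) (by omega)]
      _ = n := by simp
    exact mul_left_cancel₀ hn0 (by rw [key, mul_one])

lemma lambdaSet_eq_filter {n k : ℕ} (hk : 1 ≤ k) (hkn : k ≤ n) :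
    lambdaSet n k =
      (multiplicitySet n n).filter (fun v => ∑ j ∈ Finset.Icc 1 n, v j = k) := by
  have hsub : Finset.Icc 1 (n - k + 1) ⊆ Finset.Icc 1 n :=
    Finset.Icc_subset_Icc_right (by omega)
  ext v
  simp only [lambdaSet, Finset.mem_filter, Finset.mem_piAntidiag, mem_multiplicitySet]
  constructor
  · rintro ⟨⟨hs, hsupp⟩, hw⟩
    have h0 : ∀ j ∈ Finset.Icc 1 n, j ∉ Finset.Icc 1 (n - k + 1) → v j = 0 :=
      fun j _ hj => by_contra fun h => hj (hsupp j h)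
    refine ⟨⟨?_, fun j hj => hsub (hsupp j hj)⟩, ?_⟩
    · exact (Finset.sum_subset hsub fun j hj hj' => by simp [h0 j hj hj']).symm.trans hw
    · exact (Finset.sum_subset hsub h0).symm.trans hs
  · rintro ⟨⟨hw, hsupp⟩, hs⟩
    have hsupp' : ∀ j, v j ≠ 0 → j ∈ Finset.Icc 1 (n - k + 1) := by
      intro j hj
      have hjn := hsupp j hj
      have h1 : ∑ i ∈ (Finset.Icc 1 n).erase j, v i ≤
          ∑ i ∈ (Finset.Icc 1 n).erase j, i * v i :=
        Finset.sum_le_sum fun i hi =>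
          Nat.le_mul_of_pos_left _ (Finset.mem_Icc.mp (Finset.mem_of_mem_erase hi)).1
      rw [← Finset.add_sum_erase _ _ hjn] at hw hs
      have hj1 := (Finset.mem_Icc.mp hjn).1
      obtain ⟨a, rfl⟩ := Nat.exists_eq_add_of_le hj1
      obtain ⟨b, hb⟩ := Nat.exists_eq_succ_of_ne_zero hj
      rw [hb] at hw hs
      rw [Finset.mem_Icc]
      have : (1 + a) * b.succ = 1 + a + b + a * b := by
        rw [Nat.succ_eq_add_one]
        ring
      refine ⟨hj1, ?_⟩
      have := Nat.zero_le (a * b)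
      omega
    have h0 : ∀ j ∈ Finset.Icc 1 n, j ∉ Finset.Icc 1 (n - k + 1) → v j = 0 :=
      fun j _ hj => by_contra fun h => hj (hsupp' j h)
    refine ⟨⟨?_, hsupp'⟩, ?_⟩
    · exact (Finset.sum_subset hsub h0).trans hs
    · exact (Finset.sum_subset hsub fun j hj hj' => by simp [h0 j hj hj']).trans hw

lemma bellB_factorial {n k : ℕ} (hk : 1 ≤ k) (hkn : k ≤ n) :
    bellB n k (fun j => (Nat.factorial (j - 1) : ℝ)) =
      (Nat.factorial n : ℝ) * ∑ v ∈ lambdaSet n k, cycleWeight n v := by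
  unfold bellB cycleWeight
  congr 1
  refine Finset.sum_congr rfl fun v hv => ?_
  have hsupp := (Finset.mem_piAntidiag.mp (Finset.mem_filter.mp hv).1).2
  have hsub : Finset.Icc 1 (n - k + 1) ⊆ Finset.Icc 1 n :=
    Finset.Icc_subset_Icc_right (by omega)
  rw [← Finset.prod_subset hsub fun j _ hj => by
    rw [show v j = 0 from by_contra fun h => hj (hsupp j h)]
    simp]
  refine Finset.prod_congr rfl fun j hj => ?_
  obtain ⟨a, rfl⟩ := Nat.exists_eq_add_of_le' (Finset.mem_Icc.mp hj).1
  congr 2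
  simp only [Nat.add_sub_cancel, Nat.factorial_succ]
  have := Nat.factorial_ne_zero a
  push_cast
  field_simp

lemma sum_bellB_factorial {n : ℕ} (hn : 1 ≤ n) :
    ∑ k ∈ Finset.Icc 1 n, bellB n k (fun j => (Nat.factorial (j - 1) : ℝ)) =
      (Nat.factorial n : ℝ) := by
  calc
    _ = ∑ k ∈ Finset.Icc 1 n, (Nat.factorial n : ℝ) *
          ∑ v ∈ (multiplicitySet n n).filter (fun v => ∑ j ∈ Finset.Icc 1 n, v j = k),
            cycleWeight n v := by
      refine Finset.sum_congr rfl fun k hk => ?_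
      rw [Finset.mem_Icc] at hk
      rw [bellB_factorial hk.1 hk.2, lambdaSet_eq_filter hk.1 hk.2]
    _ = (Nat.factorial n : ℝ) * ∑ v ∈ multiplicitySet n n, cycleWeight n v := by
      rw [← Finset.mul_sum, Finset.sum_fiberwise_of_maps_to]
      intro v hv
      have hw := (mem_multiplicitySet.mp hv).1
      rw [Finset.mem_Icc, Nat.one_le_iff_ne_zero]
      constructor
      · intro h
        rw [Finset.sum_eq_zero_iff] at h
        rw [Finset.sum_eq_zero fun j hj => by rw [h j hj, mul_zero]] at hw
        omega
      · conv_rhs => rw [← hw]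
        exact Finset.sum_le_sum fun j hj =>
          Nat.le_mul_of_pos_left _ (Finset.mem_Icc.mp hj).1
    _ = (Nat.factorial n : ℝ) := by rw [sum_cycleWeight le_rfl, mul_one]

lemma bellB_congr {n k : ℕ} {u u' : ℕ → ℝ} (h : ∀ j, 1 ≤ j → u j = u' j) :
    bellB n k u = bellB n k u' := by
  unfold bellB
  congr 1
  refine Finset.sum_congr rfl fun v _ => Finset.prod_congr rfl fun j hj => ?_
  rw [h j (Finset.mem_Icc.mp hj).1]

/-- Bihomogeneity of the partial Bell polynomials. -/
lemma bellB_mul_pow_mul (n k : ℕ) (a b : ℝ) (u : ℕ → ℝ) :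
    bellB n k (fun j => a * b ^ j * u j) = a ^ k * b ^ n * bellB n k u := by
  unfold bellB
  rw [mul_left_comm, Finset.mul_sum (a := a ^ k * b ^ n)]
  congr 1
  refine Finset.sum_congr rfl fun v hv => ?_
  obtain ⟨hv, hw⟩ := Finset.mem_filter.mp hv
  have ha := Finset.prod_pow_eq_pow_sum (Finset.Icc 1 (n - k + 1)) v a
  have hb := Finset.prod_pow_eq_pow_sum (Finset.Icc 1 (n - k + 1)) (fun j => j * v j) b
  rw [(Finset.mem_piAntidiag.mp hv).1] at ha
  rw [hw] at hb
  rw [← ha, ← hb, ← Finset.prod_mul_distrib, ← Finset.prod_mul_distrib]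
  refine Finset.prod_congr rfl fun j _ => ?_
  rw [mul_div_assoc, mul_pow, mul_pow, ← pow_mul]
  ring

/-- For every `n ≥ 1`:
(i) `Σ_{k=1}^{n} (-1)^k B_{n,k}(-0!, -1!, …, -(n-k)!) = n!`;
(ii) `Σ_{k=1}^{n} (-1)^k B_{n,k}(0!, -1!, …, (-1)^{n-k}(n-k)!) = (-1)^n n!`;
(iii) `Σ_{k=1}^{n} B_{n,k}(-0!, 1!, …, (-1)^{n-k+1}(n-k)!) = (-1)^n n!`;
(iv) `Σ_{k=1}^{n} B_{n,k}(0!, 1!, …, (n-k)!) = n!`;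
where the `j`-th arguments are `-(j-1)!`, `(-1)^{j-1}(j-1)!`, `(-1)^j(j-1)!` and `(j-1)!`
respectively. -/
theorem bellB_four_identities (n : ℕ) (hn : 1 ≤ n) :
    (∑ k ∈ Finset.Icc 1 n, (-1 : ℝ) ^ k *
        bellB n k (fun j => -(Nat.factorial (j - 1) : ℝ)) = (Nat.factorial n : ℝ)) ∧
    (∑ k ∈ Finset.Icc 1 n, (-1 : ℝ) ^ k *
        bellB n k (fun j => (-1 : ℝ) ^ (j - 1) * (Nat.factorial (j - 1) : ℝ)) =
      (-1 : ℝ) ^ n * (Nat.factorial n : ℝ)) ∧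
    (∑ k ∈ Finset.Icc 1 n,
        bellB n k (fun j => (-1 : ℝ) ^ j * (Nat.factorial (j - 1) : ℝ)) =
      (-1 : ℝ) ^ n * (Nat.factorial n : ℝ)) ∧
    (∑ k ∈ Finset.Icc 1 n,
        bellB n k (fun j => (Nat.factorial (j - 1) : ℝ)) = (Nat.factorial n : ℝ)) := by
  have hsq : ∀ k : ℕ, (-1 : ℝ) ^ k * (-1 : ℝ) ^ k = 1 := fun k => by
    rw [← mul_pow]
    simp
  refine ⟨?_, ?_, ?_, sum_bellB_factorial hn⟩
  · rw [← sum_bellB_factorial hn]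
    refine Finset.sum_congr rfl fun k _ => ?_
    rw [bellB_congr (u' := fun j => (-1) * 1 ^ j * (Nat.factorial (j - 1) : ℝ))
      fun j _ => by simp, bellB_mul_pow_mul, one_pow, mul_one, ← mul_assoc, hsq, one_mul]
  · rw [← sum_bellB_factorial hn, Finset.mul_sum]
    refine Finset.sum_congr rfl fun k _ => ?_
    rw [bellB_congr (u' := fun j => (-1) * (-1) ^ j * (Nat.factorial (j - 1) : ℝ))
      fun j hj => by
        obtain ⟨i, rfl⟩ := Nat.exists_eq_add_of_le' hj
        simp [pow_succ],
      bellB_mul_pow_mul, ← mul_assoc, ← mul_assoc, hsq, one_mul]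
  · rw [← sum_bellB_factorial hn, Finset.mul_sum]
    refine Finset.sum_congr rfl fun k _ => ?_
    rw [bellB_congr (u' := fun j => 1 * (-1) ^ j * (Nat.factorial (j - 1) : ℝ))
      fun j _ => by simp, bellB_mul_pow_mul, one_pow, one_mul]
end

section
/- Let m and n be positive integers with m > n. Then Σ_{k=1}^{n} (1/k!) · (1 − 1/m)_k · B̂_{n,k}(C(m,1), C(m,2), …, C(m,n−k+1)) = C(m−1, n), where the j-th argument of B̂_{n,k} is the binomial coefficient C(m,j) = m!/(j!(m−j)!), and C(m−1,n) = (m−1)!/(n!(m−1−n)!). -/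
/-- The falling factorial `(x)_k = x(x-1)(x-2)⋯(x-k+1)`, with `(x)_0 = 1`. -/
def fallFac (x : ℝ) : ℕ → ℝ
  | 0 => 1
  | m + 1 => fallFac x m * (x - (m : ℝ))

theorem fallFac_eq_eval_descPochhammer (x : ℝ) (k : ℕ) :
    fallFac x k = (descPochhammer ℝ k).eval x := by
  induction k with
  | zero => simp [fallFac]
  | succ k ih => simp [fallFac, ih, descPochhammer_succ_right]

theorem fallFac_natCast (N k : ℕ) :
    1 / (k.factorial : ℝ) * fallFac (N : ℝ) k = (N.choose k : ℝ) := by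
  have hk : (k.factorial : ℝ) ≠ 0 := by positivity
  rw [fallFac_eq_eval_descPochhammer, descPochhammer_eval_eq_descFactorial,
    Nat.descFactorial_eq_factorial_mul_choose]
  push_cast
  field_simp

/-- `B̂_{n,k}(u)` is the coefficient of `X ^ n` in the `k`-th power of the truncated generating
polynomial of `u`. -/
theorem coeff_sum_pow_eq_bellBhat (n k : ℕ) (u : ℕ → ℝ) :
    PowerSeries.coeff n
      ((∑ j ∈ Finset.Icc 1 (n - k + 1), PowerSeries.monomial j (u j)) ^ k) = bellBhat n k u := by
  rw [Finset.sum_pow_eq_sum_piAntidiag, bellBhat, lambdaSet, Finset.sum_filter, Finset.mul_sum,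
    map_sum]
  refine Finset.sum_congr rfl fun v hv => ?_
  have hprod : ∏ j ∈ Finset.Icc 1 (n - k + 1), PowerSeries.monomial j (u j) ^ v j =
      PowerSeries.monomial (∑ j ∈ Finset.Icc 1 (n - k + 1), j * v j)
        (∏ j ∈ Finset.Icc 1 (n - k + 1), u j ^ v j) := by
    simp only [PowerSeries.monomial_eq_C_mul_X_pow, mul_pow, ← pow_mul, ← map_pow,
      Finset.prod_mul_distrib, Finset.prod_pow_eq_pow_sum, map_prod]
  have hmul := Nat.multinomial_spec (Finset.Icc 1 (n - k + 1)) v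
  rw [(Finset.mem_piAntidiag.1 hv).1] at hmul
  have hne : (∏ j ∈ Finset.Icc 1 (n - k + 1), ((v j).factorial : ℝ)) ≠ 0 :=
    Finset.prod_ne_zero_iff.2 fun j _ => by positivity
  rw [hprod, ← nsmul_eq_mul, map_nsmul, PowerSeries.coeff_monomial, nsmul_eq_mul]
  simp only [eq_comm (a := n)]
  split_ifs
  · rw [Finset.prod_div_distrib, ← hmul]
    push_cast
    field_simp
  · simp

theorem coeff_X_mul_mk_pow_eq_bellBhat {n k : ℕ} (hk : k ≤ n) (u : ℕ → ℝ) :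
    PowerSeries.coeff n ((PowerSeries.X * PowerSeries.mk fun i => u (i + 1)) ^ k) =
      bellBhat n k u := by
  have hsum : ∑ j ∈ Finset.Icc 1 (n - k + 1), PowerSeries.monomial j (u j) =
      PowerSeries.X * ((PowerSeries.trunc (n - k + 1)
        (PowerSeries.mk fun i => u (i + 1)) : Polynomial ℝ) : PowerSeries ℝ) := by
    ext (_ | i)
    · simp [PowerSeries.coeff_monomial]
    · rw [PowerSeries.coeff_succ_X_mul, Polynomial.coeff_coe, PowerSeries.coeff_trunc]
      simp [PowerSeries.coeff_monomial]
  rw [← coeff_sum_pow_eq_bellBhat, hsum, mul_pow, mul_pow, PowerSeries.coeff_X_pow_mul',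
    PowerSeries.coeff_X_pow_mul', if_pos hk, if_pos hk,
    ← PowerSeries.coeff_coe_trunc_of_lt (n - k).lt_add_one, ← PowerSeries.trunc_trunc_pow,
    PowerSeries.coeff_coe_trunc_of_lt (n - k).lt_add_one]

theorem X_mul_mk_choose_add_one (m : ℕ) :
    (PowerSeries.X * PowerSeries.mk fun i => (m.choose (i + 1) : ℝ)) + 1 =
      (((1 + Polynomial.X) ^ m : Polynomial ℝ) : PowerSeries ℝ) := by
  ext (_ | i) <;>
    rw [Polynomial.coeff_coe, Polynomial.coeff_one_add_X_pow] <;>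
    simp [PowerSeries.coeff_succ_X_mul, PowerSeries.coeff_one]

theorem sum_choose_mul_bellBhat (m N : ℕ) {n : ℕ} (hn : 1 ≤ n) :
    ∑ k ∈ Finset.Icc 1 n, (N.choose k : ℝ) * bellBhat n k (fun j => (m.choose j : ℝ)) =
      ((m * N).choose n : ℝ) := by
  set P : PowerSeries ℝ := PowerSeries.X * PowerSeries.mk fun i => (m.choose (i + 1) : ℝ) with hP
  have hcoeff : PowerSeries.coeff n ((P + 1) ^ N) = ((m * N).choose n : ℝ) := by
    rw [X_mul_mk_choose_add_one, ← Polynomial.coe_pow, ← pow_mul, Polynomial.coeff_coe,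
      Polynomial.coeff_one_add_X_pow]
  have hzero : ∀ k, k ∉ Finset.Icc 1 n → PowerSeries.coeff n (P ^ k) = 0 := by
    intro k hk
    rcases Nat.eq_zero_or_pos k with rfl | hk0
    · simp [PowerSeries.coeff_one, Nat.one_le_iff_ne_zero.1 hn]
    · rw [hP, mul_pow, PowerSeries.coeff_X_pow_mul', if_neg]
      intro h
      exact hk (Finset.mem_Icc.2 ⟨hk0, h⟩)
  rw [← hcoeff, add_pow, map_sum]
  have hterm : ∀ k, PowerSeries.coeff n (P ^ k * 1 ^ (N - k) * (N.choose k : PowerSeries ℝ)) =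
      (N.choose k : ℝ) * PowerSeries.coeff n (P ^ k) := by
    intro k
    rw [one_pow, mul_one, mul_comm, ← nsmul_eq_mul, map_nsmul, nsmul_eq_mul]
  simp only [hterm]
  calc _ = ∑ k ∈ Finset.Icc 1 n, (N.choose k : ℝ) * PowerSeries.coeff n (P ^ k) :=
        Finset.sum_congr rfl fun k hk => by
          rw [← coeff_X_mul_mk_pow_eq_bellBhat (Finset.mem_Icc.1 hk).2]
    _ = ∑ k ∈ Finset.Icc 1 n ∪ Finset.range (N + 1),
          (N.choose k : ℝ) * PowerSeries.coeff n (P ^ k) :=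
        Finset.sum_subset Finset.subset_union_left fun k _ hk => by rw [hzero k hk, mul_zero]
    _ = _ := (Finset.sum_subset Finset.subset_union_right fun k _ hk => by
        rw [Nat.choose_eq_zero_of_lt (by simpa using hk), Nat.cast_zero, zero_mul]).symm

/-- Both sides are polynomials in `x` which agree at all natural numbers. -/
theorem sum_fallFac_mul_bellBhat (m : ℕ) {n : ℕ} (hn : 1 ≤ n) (x : ℝ) :
    ∑ k ∈ Finset.Icc 1 n, (1 / (k.factorial : ℝ)) * fallFac x k *
      bellBhat n k (fun j => (m.choose j : ℝ)) =
        1 / (n.factorial : ℝ) * fallFac (m * x) n := by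
  let p : Polynomial ℝ := ∑ k ∈ Finset.Icc 1 n, Polynomial.C (1 / (k.factorial : ℝ)) *
    descPochhammer ℝ k * Polynomial.C (bellBhat n k (fun j => (m.choose j : ℝ)))
  let q : Polynomial ℝ := Polynomial.C (1 / (n.factorial : ℝ)) *
    (descPochhammer ℝ n).comp (Polynomial.C (m : ℝ) * Polynomial.X)
  have hp : ∀ y, p.eval y = ∑ k ∈ Finset.Icc 1 n, (1 / (k.factorial : ℝ)) * fallFac y k *
      bellBhat n k (fun j => (m.choose j : ℝ)) := fun y => by
    simp only [p, Polynomial.eval_finsetSum, Polynomial.eval_mul, Polynomial.eval_C,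
      fallFac_eq_eval_descPochhammer]
  have hq : ∀ y, q.eval y = 1 / (n.factorial : ℝ) * fallFac (m * y) n := fun y => by
    simp only [q, Polynomial.eval_mul, Polynomial.eval_C, Polynomial.eval_comp,
      Polynomial.eval_X, fallFac_eq_eval_descPochhammer]
  rw [← hp, ← hq]
  congr 1
  refine Polynomial.eq_of_infinite_eval_eq p q
    ((Set.infinite_range_of_injective (Nat.cast_injective (R := ℝ))).mono ?_)
  rintro _ ⟨N, rfl⟩
  rw [Set.mem_ofPred_eq, hp, hq, ← Nat.cast_mul]
  simp only [fallFac_natCast]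
  exact sum_choose_mul_bellBhat m N hn

/-- For positive integers `m > n`:
`Σ_{k=1}^{n} (1/k!)(1 - 1/m)_k B̂_{n,k}(C(m,1), C(m,2), …, C(m,n-k+1)) = C(m-1, n)`,
where the `j`-th argument is the binomial coefficient `C(m,j)`. -/
theorem bellBhat_binomial_identity (m n : ℕ) (hn : 1 ≤ n) (hm : n < m) :
    ∑ k ∈ Finset.Icc 1 n, (1 / (Nat.factorial k : ℝ)) * fallFac (1 - 1 / (m : ℝ)) k *
      bellBhat n k (fun j => (Nat.choose m j : ℝ)) = (Nat.choose (m - 1) n : ℝ) := by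
  have hm0 : (m : ℝ) ≠ 0 := Nat.cast_ne_zero.2 (by omega)
  have hx : (m : ℝ) * (1 - 1 / m) = ((m - 1 : ℕ) : ℝ) := by
    rw [Nat.cast_sub (by omega)]
    field_simp
    simp
  rw [sum_fallFac_mul_bellBhat m hn, hx, fallFac_natCast]
end
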